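/- Let M be a right A-module, N a left A-module, f : M → M a right δ-operator, and g : N → N a δ-operator. For a left A-module P write T(M, P) = (M ⊗_k P)/S_P, where S_P is the k-submodule spanned by the elements ma ⊗ p − m ⊗ ap; A-linear maps P → P' induce k-linear maps T(M, P) → T(M, P'). Let η : Q_• → N be a projective resolution of N by left A-modules, and let g_• and g'_• be two δ-liftings of g to Q_•. Then each map f ⊠ g_i (respectively f ⊠ g'_i), determined by m ⊗ q ↦ f(m) ⊗ q + m ⊗ g_i(q), descends to a k-linear endomorphism of T(M, Q_i), these form chain maps of the complex T(M, Q_•) (with differentials induced by id_M ⊗ d_i), and the two chain maps so obtained are chain homotopic; in particular they induce the same map on the homology of T(M, Q_•). -/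

import Mathlib

open MulOpposite TensorProduct

section

variable {k A M : Type*} [CommRing k] [Ring A] [Algebra k A]
  [AddCommGroup M] [Module k M] [Module Aᵐᵒᵖ M] [IsScalarTower k Aᵐᵒᵖ M]

/-- For a right `A`-module `M` and a left `A`-module `P`, the `k`-submodule `S_P` of
`M ⊗[k] P` spanned by the elements `(m·a) ⊗ p − m ⊗ (a·p)`. -/
def tensorRelators (k A : Type*) {M : Type*} (P : Type*) [CommRing k] [Ring A] [Algebra k A]
    [AddCommGroup M] [Module k M] [Module Aᵐᵒᵖ M] [IsScalarTower k Aᵐᵒᵖ M]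
    [AddCommGroup P] [Module k P] [Module A P] [IsScalarTower k A P] :
    Submodule k (M ⊗[k] P) :=
  Submodule.span k
    {x : M ⊗[k] P | ∃ (m : M) (a : A) (p : P), x = (op a • m) ⊗ₜ[k] p - m ⊗ₜ[k] (a • p)}

/-- `T(M, P) = (M ⊗[k] P) ⧸ S_P`, which computes `M ⊗[A] P`. -/
abbrev TensorOverA (k A : Type*) {M : Type*} (P : Type*) [CommRing k] [Ring A] [Algebra k A]
    [AddCommGroup M] [Module k M] [Module Aᵐᵒᵖ M] [IsScalarTower k Aᵐᵒᵖ M]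
    [AddCommGroup P] [Module k P] [Module A P] [IsScalarTower k A P] :=
  (M ⊗[k] P) ⧸ tensorRelators k A P

/-- An `A`-linear map `u : P → P'` induces a `k`-linear map `T(M, P) → T(M, P')`. -/
noncomputable def TensorOverA.map {P P' : Type*}
    [AddCommGroup P] [Module k P] [Module A P] [IsScalarTower k A P]
    [AddCommGroup P'] [Module k P'] [Module A P'] [IsScalarTower k A P']
    (u : P →ₗ[A] P') :
    TensorOverA k A (M := M) P →ₗ[k] TensorOverA k A (M := M) P' :=
  Submodule.mapQ _ _ (TensorProduct.map LinearMap.id (u.restrictScalars k)) (by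
    apply Submodule.span_le.mpr
    rintro x ⟨m, a, p, rfl⟩
    refine Submodule.mem_comap.mpr ?_
    have h : (TensorProduct.map LinearMap.id (u.restrictScalars k))
          ((op a • m) ⊗ₜ[k] p - m ⊗ₜ[k] (a • p))
        = (op a • m) ⊗ₜ[k] (u p) - m ⊗ₜ[k] (a • u p) := by
      simp [map_sub, TensorProduct.map_tmul]
    rw [h]
    exact Submodule.subset_span ⟨m, a, u p, rfl⟩)

end

section

variable {k A M P P' P'' : Type*} [CommRing k] [Ring A] [Algebra k A]
  [AddCommGroup M] [Module k M] [Module Aᵐᵒᵖ M] [IsScalarTower k Aᵐᵒᵖ M]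
  [AddCommGroup P] [Module k P] [Module A P] [IsScalarTower k A P]
  [AddCommGroup P'] [Module k P'] [Module A P'] [IsScalarTower k A P']
  [AddCommGroup P''] [Module k P''] [Module A P''] [IsScalarTower k A P'']

namespace TensorOverA

theorem hom_ext {X : Type*} [AddCommGroup X] [Module k X]
    {u v : TensorOverA k A (M := M) P →ₗ[k] X}
    (h : ∀ (m : M) (p : P), u ((tensorRelators k A P).mkQ (m ⊗ₜ[k] p))
      = v ((tensorRelators k A P).mkQ (m ⊗ₜ[k] p))) : u = v :=
  Submodule.linearMap_qext _ (TensorProduct.ext' h)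

theorem map_mkQ_tmul (u : P →ₗ[A] P') (m : M) (p : P) :
    TensorOverA.map (k := k) u ((tensorRelators k A P).mkQ (m ⊗ₜ[k] p))
      = (tensorRelators k A P').mkQ (m ⊗ₜ[k] u p) :=
  rfl

theorem map_add (u v : P →ₗ[A] P') :
    TensorOverA.map (k := k) (M := M) (u + v) = TensorOverA.map u + TensorOverA.map v :=
  hom_ext fun m p => by
    simp only [LinearMap.add_apply, map_mkQ_tmul, TensorProduct.tmul_add, _root_.map_add]

theorem map_comp (v : P' →ₗ[A] P'') (u : P →ₗ[A] P') :
    TensorOverA.map (k := k) (M := M) (v ∘ₗ u) = TensorOverA.map v ∘ₗ TensorOverA.map u :=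
  hom_ext fun _ _ => rfl

/-- The endomorphism `f ⊠ g` of `T(M, P)` induced by `m ⊗ p ↦ f m ⊗ p + m ⊗ g p`. -/
noncomputable def boxtimes {δ : A → A} (f : M →ₗ[k] M)
    (hf : ∀ (a : A) (m : M), f (op a • m) = op a • f m + op (δ a) • m)
    (g : P →ₗ[k] P) (hg : ∀ (a : A) (p : P), g (a • p) = δ a • p + a • g p) :
    TensorOverA k A (M := M) P →ₗ[k] TensorOverA k A (M := M) P :=
  Submodule.mapQ _ _
    (TensorProduct.map f LinearMap.id + TensorProduct.map LinearMap.id g) (by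
      apply Submodule.span_le.mpr
      rintro x ⟨m, a, p, rfl⟩
      have mem (m : M) (a : A) (p : P) :
          (op a • m) ⊗ₜ[k] p - m ⊗ₜ[k] (a • p) ∈ tensorRelators k A P :=
        Submodule.subset_span ⟨m, a, p, rfl⟩
      refine Submodule.mem_comap.mpr ?_
      convert add_mem (add_mem (mem (f m) a p) (mem m (δ a) p)) (mem m a (g p)) using 1
      simp only [map_sub, LinearMap.add_apply, TensorProduct.map_tmul, LinearMap.id_apply,
        hf, hg, TensorProduct.add_tmul, TensorProduct.tmul_add]
      abel)

section boxtimes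

variable {δ : A → A} {f : M →ₗ[k] M}
  (hf : ∀ (a : A) (m : M), f (op a • m) = op a • f m + op (δ a) • m)

theorem boxtimes_mkQ_tmul {g : P →ₗ[k] P}
    (hg : ∀ (a : A) (p : P), g (a • p) = δ a • p + a • g p) (m : M) (p : P) :
    boxtimes f hf g hg ((tensorRelators k A P).mkQ (m ⊗ₜ[k] p))
      = (tensorRelators k A P).mkQ (f m ⊗ₜ[k] p + m ⊗ₜ[k] g p) :=
  rfl

theorem map_boxtimes {g : P →ₗ[k] P} {g' : P' →ₗ[k] P'}
    (hg : ∀ (a : A) (p : P), g (a • p) = δ a • p + a • g p)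
    (hg' : ∀ (a : A) (p : P'), g' (a • p) = δ a • p + a • g' p)
    (u : P →ₗ[A] P') (hu : ∀ p, u (g p) = g' (u p)) (x : TensorOverA k A (M := M) P) :
    TensorOverA.map u (boxtimes f hf g hg x) = boxtimes f hf g' hg' (TensorOverA.map u x) := by
  refine LinearMap.congr_fun (f := TensorOverA.map u ∘ₗ boxtimes f hf g hg)
    (g := boxtimes f hf g' hg' ∘ₗ TensorOverA.map u) (hom_ext fun m p => ?_) x
  simp only [LinearMap.comp_apply, boxtimes_mkQ_tmul, map_mkQ_tmul, _root_.map_add, hu]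

theorem boxtimes_sub_boxtimes {g g' : P →ₗ[k] P}
    (hg : ∀ (a : A) (p : P), g (a • p) = δ a • p + a • g p)
    (hg' : ∀ (a : A) (p : P), g' (a • p) = δ a • p + a • g' p)
    (h : P →ₗ[A] P) (hh : ∀ p, h p = g p - g' p) (x : TensorOverA k A (M := M) P) :
    boxtimes f hf g hg x - boxtimes f hf g' hg' x = TensorOverA.map h x := by
  refine LinearMap.congr_fun (f := boxtimes f hf g hg - boxtimes f hf g' hg')
    (hom_ext fun m p => ?_) x
  simp only [LinearMap.sub_apply, boxtimes_mkQ_tmul, map_mkQ_tmul, hh, ← map_sub,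
    TensorProduct.tmul_sub, add_sub_add_left_eq_sub]

end boxtimes

end TensorOverA

/-- The difference of two `δ`-operators is `A`-linear. -/
def deltaOperatorSub {δ : A → A} (g g' : P →ₗ[k] P)
    (hg : ∀ (a : A) (p : P), g (a • p) = δ a • p + a • g p)
    (hg' : ∀ (a : A) (p : P), g' (a • p) = δ a • p + a • g' p) : P →ₗ[A] P where
  toFun p := g p - g' p
  map_add' p q := by simp only [map_add, add_sub_add_comm]
  map_smul' a p := by
    simp only [hg, hg', add_sub_add_left_eq_sub, smul_sub, RingHom.id_apply]

end

/-- A linear map out of a projective module factors through any map whose range contains its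
range. -/
theorem Module.Projective.exists_comp_eq_of_range_le {A P X Y : Type*} [Ring A]
    [AddCommGroup P] [Module A P] [AddCommGroup X] [Module A X] [AddCommGroup Y] [Module A Y]
    [Module.Projective A P] (d : X →ₗ[A] Y) (u : P →ₗ[A] Y)
    (h : LinearMap.range u ≤ LinearMap.range d) : ∃ s : P →ₗ[A] X, d ∘ₗ s = u := by
  obtain ⟨s, hs⟩ := Module.projective_lifting_property d.rangeRestrict
    (u.codRestrict (LinearMap.range d) fun p => h ⟨p, rfl⟩) d.surjective_rangeRestrict
  exact ⟨s, LinearMap.ext fun p => congrArg Subtype.val (LinearMap.congr_fun hs p)⟩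

/-- A chain endomorphism of a projective resolution lifting the zero map is null-homotopic. -/
theorem exists_nullHomotopy_of_projective_resolution {A N : Type*} [Ring A]
    [AddCommGroup N] [Module A N]
    (Q : ℕ → Type*) [∀ i, AddCommGroup (Q i)] [∀ i, Module A (Q i)]
    [∀ i, Module.Projective A (Q i)]
    (d : ∀ i, Q (i + 1) →ₗ[A] Q i) (η : Q 0 →ₗ[A] N)
    (hexact0 : LinearMap.ker η = LinearMap.range (d 0))
    (hexact : ∀ i, LinearMap.ker (d i) = LinearMap.range (d (i + 1)))
    (h : ∀ i, Q i →ₗ[A] Q i) (hη : η ∘ₗ h 0 = 0)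
    (hd : ∀ i, d i ∘ₗ h (i + 1) = h i ∘ₗ d i) :
    ∃ s : ∀ i, Q i →ₗ[A] Q (i + 1), h 0 = d 0 ∘ₗ s 0 ∧
      ∀ i, h (i + 1) = d (i + 1) ∘ₗ s (i + 1) + s i ∘ₗ d i := by
  have hdd (i : ℕ) : d i ∘ₗ d (i + 1) = 0 :=
    LinearMap.range_le_ker_iff.mp (hexact i).ge
  obtain ⟨s₀, hs₀⟩ := Module.Projective.exists_comp_eq_of_range_le (d 0) (h 0)
    (hexact0 ▸ LinearMap.range_le_ker_iff.mpr hη)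
  have step (i : ℕ) (s : Q i →ₗ[A] Q (i + 1)) (hs : d i ∘ₗ s ∘ₗ d i = h i ∘ₗ d i) :
      ∃ t : Q (i + 1) →ₗ[A] Q (i + 2), d (i + 1) ∘ₗ t = h (i + 1) - s ∘ₗ d i :=
    Module.Projective.exists_comp_eq_of_range_le _ _
      (hexact i ▸ LinearMap.range_le_ker_iff.mpr
        (by rw [LinearMap.comp_sub, hs, hd, sub_self]))
  choose next hnext using step
  have next_spec (i : ℕ) (s : Q i →ₗ[A] Q (i + 1)) (hs : d i ∘ₗ s ∘ₗ d i = h i ∘ₗ d i) :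
      d (i + 1) ∘ₗ next i s hs ∘ₗ d (i + 1) = h (i + 1) ∘ₗ d (i + 1) := by
    rw [← LinearMap.comp_assoc, hnext, LinearMap.sub_comp, LinearMap.comp_assoc, hdd,
      LinearMap.comp_zero, sub_zero]
  let s (i : ℕ) : {s : Q i →ₗ[A] Q (i + 1) // d i ∘ₗ s ∘ₗ d i = h i ∘ₗ d i} :=
    Nat.rec ⟨s₀, by rw [← LinearMap.comp_assoc, hs₀]⟩
      (fun i t => ⟨next i t.1 t.2, next_spec i t.1 t.2⟩) i
  exact ⟨fun i => (s i).1, hs₀.symm,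
    fun i => eq_add_of_sub_eq (hnext i (s i).1 (s i).2).symm⟩

/-- **Theorem (`f ⊠ g` on `Tor`, independence of the lifting).** Let `f` be a right
`δ`-operator on a right `A`-module `M`, `g` a `δ`-operator on a left `A`-module `N`,
`Q_•` a projective resolution of `N`, and `g_•`, `g'_•` two `δ`-liftings of `g` to `Q_•`.
Then the maps `f ⊠ g_i` and `f ⊠ g'_i` descend to `k`-linear endomorphisms `G`, `G'` of
`T(M, Q_i) = (M ⊗[k] Q_i)/S`, these are chain maps for the differentials induced by
`id_M ⊗ d_i`, the two chain maps are chain homotopic, and they induce the same map on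
the homology of `T(M, Q_•)`. -/
theorem boxtimes_liftings_chain_homotopic
    {k A M N : Type*} [CommRing k] [Ring A] [Algebra k A]
    [AddCommGroup M] [Module k M] [Module Aᵐᵒᵖ M] [IsScalarTower k Aᵐᵒᵖ M]
    [AddCommGroup N] [Module k N] [Module A N] [IsScalarTower k A N]
    (δ : A →ₗ[k] A) (hδ : ∀ a b : A, δ (a * b) = δ a * b + a * δ b)
    (f : M →ₗ[k] M) (hf : ∀ (a : A) (m : M), f (op a • m) = op a • f m + op (δ a) • m)
    (gN : N →ₗ[k] N) (hgN : ∀ (a : A) (n : N), gN (a • n) = δ a • n + a • gN n)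
    (Q : ℕ → Type*) [∀ i, AddCommGroup (Q i)] [∀ i, Module k (Q i)]
    [∀ i, Module A (Q i)] [∀ i, IsScalarTower k A (Q i)]
    [∀ i, Module.Projective A (Q i)]
    (d : ∀ i, Q (i + 1) →ₗ[A] Q i) (η : Q 0 →ₗ[A] N)
    (hsurj : Function.Surjective η)
    (hexact0 : LinearMap.ker η = LinearMap.range (d 0))
    (hexact : ∀ i, LinearMap.ker (d i) = LinearMap.range (d (i + 1)))
    (g g' : ∀ i, Q i →ₗ[k] Q i)
    (hg0 : ∀ i (a : A) (q : Q i), g i (a • q) = δ a • q + a • g i q)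
    (hg'0 : ∀ i (a : A) (q : Q i), g' i (a • q) = δ a • q + a • g' i q)
    (hgη : ∀ q : Q 0, η (g 0 q) = gN (η q))
    (hg'η : ∀ q : Q 0, η (g' 0 q) = gN (η q))
    (hgd : ∀ i (q : Q (i + 1)), d i (g (i + 1) q) = g i (d i q))
    (hg'd : ∀ i (q : Q (i + 1)), d i (g' (i + 1) q) = g' i (d i q)) :
    ∃ G G' : ∀ i, TensorOverA k A (M := M) (Q i) →ₗ[k] TensorOverA k A (M := M) (Q i),
      -- `G i` and `G' i` are induced by `f ⊠ g_i` and `f ⊠ g'_i`: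
      (∀ i (z : M ⊗[k] Q i),
        G i ((tensorRelators k A (Q i)).mkQ z)
          = (tensorRelators k A (Q i)).mkQ
              ((TensorProduct.map f LinearMap.id + TensorProduct.map LinearMap.id (g i)
                : M ⊗[k] Q i →ₗ[k] M ⊗[k] Q i) z)) ∧
      (∀ i (z : M ⊗[k] Q i),
        G' i ((tensorRelators k A (Q i)).mkQ z)
          = (tensorRelators k A (Q i)).mkQ
              ((TensorProduct.map f LinearMap.id + TensorProduct.map LinearMap.id (g' i)
                : M ⊗[k] Q i →ₗ[k] M ⊗[k] Q i) z)) ∧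
      -- they are chain maps for the induced differentials:
      (∀ i (x : TensorOverA k A (M := M) (Q (i + 1))),
        TensorOverA.map (d i) (G (i + 1) x) = G i (TensorOverA.map (d i) x)) ∧
      (∀ i (x : TensorOverA k A (M := M) (Q (i + 1))),
        TensorOverA.map (d i) (G' (i + 1) x) = G' i (TensorOverA.map (d i) x)) ∧
      -- the two chain maps are chain homotopic:
      (∃ s : ∀ i, TensorOverA k A (M := M) (Q i) →ₗ[k] TensorOverA k A (M := M) (Q (i + 1)),
        (∀ x : TensorOverA k A (M := M) (Q 0),
          G 0 x - G' 0 x = TensorOverA.map (d 0) (s 0 x)) ∧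
        (∀ i (x : TensorOverA k A (M := M) (Q (i + 1))),
          G (i + 1) x - G' (i + 1) x
            = TensorOverA.map (d (i + 1)) (s (i + 1) x) + s i (TensorOverA.map (d i) x))) ∧
      -- in particular they induce the same map on homology:
      (∀ x : TensorOverA k A (M := M) (Q 0),
        G 0 x - G' 0 x ∈ LinearMap.range (TensorOverA.map (M := M) (d 0))) ∧
      (∀ i (x : TensorOverA k A (M := M) (Q (i + 1))),
        TensorOverA.map (d i) x = 0 →
        G (i + 1) x - G' (i + 1) x ∈ LinearMap.range (TensorOverA.map (M := M) (d (i + 1)))) := by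
  let h (i : ℕ) : Q i →ₗ[A] Q i := deltaOperatorSub (g i) (g' i) (hg0 i) (hg'0 i)
  have h_apply (i : ℕ) (q : Q i) : h i q = g i q - g' i q := rfl
  obtain ⟨s, hs0, hs⟩ := exists_nullHomotopy_of_projective_resolution Q d η hexact0 hexact h
    (LinearMap.ext fun q => by simp [h_apply, hgη, hg'η])
    (fun i => LinearMap.ext fun q => by simp [h_apply, hgd, hg'd])
  have homotopy0 (x : TensorOverA k A (M := M) (Q 0)) :
      TensorOverA.boxtimes f hf (g 0) (hg0 0) x - TensorOverA.boxtimes f hf (g' 0) (hg'0 0) x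
        = TensorOverA.map (d 0) (TensorOverA.map (s 0) x) := by
    rw [TensorOverA.boxtimes_sub_boxtimes hf _ _ (h 0) (h_apply 0), hs0, TensorOverA.map_comp,
      LinearMap.comp_apply]
  have homotopy (i : ℕ) (x : TensorOverA k A (M := M) (Q (i + 1))) :
      TensorOverA.boxtimes f hf (g (i + 1)) (hg0 (i + 1)) x
          - TensorOverA.boxtimes f hf (g' (i + 1)) (hg'0 (i + 1)) x
        = TensorOverA.map (d (i + 1)) (TensorOverA.map (s (i + 1)) x)
          + TensorOverA.map (s i) (TensorOverA.map (d i) x) := by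
    rw [TensorOverA.boxtimes_sub_boxtimes hf _ _ (h (i + 1)) (h_apply (i + 1)), hs,
      TensorOverA.map_add, TensorOverA.map_comp, TensorOverA.map_comp, LinearMap.add_apply,
      LinearMap.comp_apply, LinearMap.comp_apply]
  refine ⟨fun i => TensorOverA.boxtimes f hf (g i) (hg0 i),
    fun i => TensorOverA.boxtimes f hf (g' i) (hg'0 i), fun _ _ => rfl, fun _ _ => rfl,
    fun i => TensorOverA.map_boxtimes hf _ _ (d i) (hgd i),
    fun i => TensorOverA.map_boxtimes hf _ _ (d i) (hg'd i),
    ⟨fun i => TensorOverA.map (s i), homotopy0, homotopy⟩,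
    fun x => ⟨_, (homotopy0 x).symm⟩, fun i x hx => ⟨TensorOverA.map (s (i + 1)) x, ?_⟩⟩
  rw [homotopy, hx, map_zero, add_zero]
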